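/- arXiv:1412.7462 — 3 statements merged into one kernel-verified Lean document; each statement's English description precedes it below -/
import Mathlib

section
/- There exists a constant α_W ∈ (0, ∞) depending only on W and the dimension d such that λ_d( B(x, u) ∩ B(0, ‖x‖) ∩ W ) ≥ α_W · κ_d · u^d for all x ∈ W and all real u with 0 ≤ u ≤ ‖x‖. -/
open MeasureTheory Metric

/-- A convex set of positive volume has nonempty interior. -/
theorem Convex.interior_nonempty_of_volume_pos {d : ℕ} {W : Set (EuclideanSpace ℝ (Fin d))}
    (hW : Convex ℝ W) (hvol : 0 < volume W) : (interior W).Nonempty := by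
  by_contra h
  rw [Set.not_nonempty_iff_eq_empty] at h
  have hsub : W ⊆ frontier W := by
    rw [frontier, h, Set.sdiff_empty]
    exact subset_closure
  exact hvol.ne' (measure_mono_null hsub (hW.addHaar_frontier volume))

/-- If a convex set `W` contains `0` and a ball of radius `r`, and lies in the ball of radius `D`
around `0`, then for each `x ∈ W` and `0 < u ≤ ‖x‖` the set `B(x, u) ∩ B(0, ‖x‖) ∩ W` contains a
ball of radius `2 r u / (9 D)`. -/
theorem exists_closedBall_subset_inter {E : Type*} [NormedAddCommGroup E] [NormedSpace ℝ E]
    {W : Set E} (hW : Convex ℝ W) (h0 : (0 : E) ∈ W) {w : E} {r D : ℝ} (hr : 0 < r)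
    (hball : closedBall w r ⊆ W) (hD : 0 < D) (hWD : ∀ z ∈ W, ‖z‖ ≤ D)
    {x : E} (hx : x ∈ W) {u : ℝ} (hu : 0 < u) (hux : u ≤ ‖x‖) :
    ∃ y, closedBall y (2 * r / (9 * D) * u) ⊆ closedBall x u ∩ closedBall 0 ‖x‖ ∩ W := by
  have hxpos : 0 < ‖x‖ := hu.trans_le hux
  have hxD := hWD x hx
  obtain ⟨s, hs⟩ : ∃ s, s = u / (3 * ‖x‖) := ⟨_, rfl⟩
  obtain ⟨t, ht⟩ : ∃ t, t = u / (3 * D) := ⟨_, rfl⟩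
  have hs0 : 0 < s := hs ▸ by positivity
  have ht0 : 0 < t := ht ▸ by positivity
  have hsx : s * ‖x‖ = u / 3 := by rw [hs]; field_simp
  have htD : t * D = u / 3 := by rw [ht]; field_simp
  have hs1 : s ≤ 1 / 3 := by rw [hs, div_le_iff₀ (by positivity)]; linarith
  have ht1 : t ≤ 1 / 3 := by rw [ht, div_le_iff₀ (by positivity)]; linarith
  have hst : 0 < (1 - s) * t := mul_pos (by linarith) ht0
  refine ⟨(1 - s) • ((1 - t) • x + t • w), fun z hz => ?_⟩
  obtain ⟨b, hb⟩ : ∃ b, b = w + ((1 - s) * t)⁻¹ • (z - (1 - s) • ((1 - t) • x + t • w)) :=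
    ⟨_, rfl⟩
  have hzb : z = (1 - s) • ((1 - t) • x + t • b) := by
    have h : ((1 - s) * t) • b = ((1 - s) * t) • w +
        (z - (1 - s) • ((1 - t) • x + t • w)) := by
      rw [hb, smul_add, smul_inv_smul₀ hst.ne']
    calc z = ((1 - s) * t) • w + (z - (1 - s) • ((1 - t) • x + t • w))
          + ((1 - s) * (1 - t)) • x := by module
      _ = _ := by rw [← h]; module
  have hbW : b ∈ W := by
    apply hball
    rw [mem_closedBall, dist_eq_norm, hb, add_sub_cancel_left, norm_smul, norm_inv,
      Real.norm_of_nonneg hst.le, inv_mul_le_iff₀ hst, ← dist_eq_norm]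
    refine (mem_closedBall.1 hz).trans ?_
    have : 2 * r / (9 * D) * u = 2 / 3 * t * r := by rw [ht]; field_simp; norm_num
    rw [this]
    gcongr
    linarith
  have hbD := hWD b hbW
  have htb : t * ‖b‖ ≤ u / 3 := htD ▸ mul_le_mul_of_nonneg_left hbD ht0.le
  have htx : t * ‖x‖ ≤ u / 3 := htD ▸ mul_le_mul_of_nonneg_left hxD ht0.le
  have hcW : (1 - t) • x + t • b ∈ W :=
    hW hx hbW (by linarith) ht0.le (by ring)
  refine ⟨⟨?_, ?_⟩, ?_⟩
  · rw [mem_closedBall, dist_eq_norm]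
    have h : z - x = (1 - s) • (t • b - t • x) - s • x := by rw [hzb]; module
    have h1 : ‖t • b - t • x‖ ≤ t * ‖b‖ + t * ‖x‖ := by
      simpa [norm_smul, abs_of_pos ht0] using norm_sub_le (t • b) (t • x)
    have h2 : ‖(1 - s) • (t • b - t • x)‖ ≤ ‖t • b - t • x‖ := by
      rw [norm_smul, Real.norm_of_nonneg (by linarith)]
      exact mul_le_of_le_one_left (norm_nonneg _) (by linarith)
    have h3 : ‖s • x‖ = u / 3 := by rw [norm_smul, Real.norm_of_nonneg hs0.le, hsx]
    rw [h]
    linarith [norm_sub_le ((1 - s) • (t • b - t • x)) (s • x)]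
  · rw [mem_closedBall, dist_zero_right, hzb, norm_smul, Real.norm_of_nonneg (by linarith)]
    have h1 : ‖(1 - t) • x + t • b‖ ≤ (1 + s) * ‖x‖ := by
      refine (norm_add_le _ _).trans ?_
      rw [norm_smul, norm_smul, Real.norm_of_nonneg ht0.le, Real.norm_of_nonneg (by linarith)]
      nlinarith
    calc (1 - s) * ‖(1 - t) • x + t • b‖ ≤ (1 - s) * ((1 + s) * ‖x‖) :=
          mul_le_mul_of_nonneg_left h1 (by linarith)
      _ ≤ ‖x‖ := by nlinarith [mul_nonneg (sq_nonneg s) hxpos.le]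
  · rw [hzb]
    exact hW.smul_mem_of_zero_mem h0 hcW ⟨by linarith, by linarith⟩

/-- There is a constant `α_W ∈ (0, ∞)`, depending only on `W` and the dimension `d`, such that
`λ_d(B(x,u) ∩ B(0,‖x‖) ∩ W) ≥ α_W · κ_d · u^d` for all `x ∈ W` and `0 ≤ u ≤ ‖x‖`. -/
theorem exists_alphaW
    (d : ℕ) (hd : 2 ≤ d)
    (W : Set (EuclideanSpace ℝ (Fin d))) (hWcompact : IsCompact W)
    (hWconvex : Convex ℝ W) (hW0 : (0 : EuclideanSpace ℝ (Fin d)) ∈ W)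
    (hWvol : 0 < volume W) :
    ∃ α : ℝ, 0 < α ∧ ∀ x ∈ W, ∀ u : ℝ, 0 ≤ u → u ≤ ‖x‖ →
      α * (volume (closedBall (0 : EuclideanSpace ℝ (Fin d)) 1)).toReal * u ^ d ≤
        (volume (closedBall x u ∩ closedBall (0 : EuclideanSpace ℝ (Fin d)) ‖x‖ ∩ W)).toReal := by
  obtain ⟨w, hw⟩ := hWconvex.interior_nonempty_of_volume_pos hWvol
  obtain ⟨r, hr, hball⟩ := nhds_basis_closedBall.mem_iff.1 (mem_interior_iff_mem_nhds.1 hw)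
  obtain ⟨D, hD, hWD⟩ := hWcompact.isBounded.exists_pos_norm_le
  refine ⟨(2 * r / (9 * D)) ^ d, by positivity, fun x hx u hu hux => ?_⟩
  rcases hu.eq_or_lt with rfl | hu
  · rw [zero_pow (by lia), mul_zero]
    exact ENNReal.toReal_nonneg
  obtain ⟨y, hy⟩ := exists_closedBall_subset_inter hWconvex hW0 hr hball hD hWD hx hu hux
  have hfin : volume (closedBall x u ∩ closedBall 0 ‖x‖ ∩ W) ≠ ⊤ :=
    measure_ne_top_of_subset Set.inter_subset_right hWcompact.measure_ne_top
  refine le_trans (le_of_eq ?_) (ENNReal.toReal_mono hfin (measure_mono hy))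
  rw [Measure.addHaar_closedBall' volume y (by positivity), ENNReal.toReal_mul,
    ENNReal.toReal_ofReal (by positivity), finrank_euclideanSpace_fin, mul_pow]
  ring
end

section
/- For every point x in the interior of W with x ≠ 0 and every u ≥ 0, one has lim_{t→∞} t · λ_d( B(x, t^{−1/d}·u) ∩ B(0, ‖x‖) ∩ W ) = (κ_d / 2) · u^d. -/
open MeasureTheory Metric Filter
open scoped Topology

section HalfBall

open scoped Pointwise

variable {E : Type*} [NormedAddCommGroup E] [InnerProductSpace ℝ E] [FiniteDimensional ℝ E]
  [MeasurableSpace E] [BorelSpace E] (μ : Measure E) [μ.IsAddHaarMeasure]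

/-- The hyperplane orthogonal to a nonzero vector is a null set. -/
lemma ae_inner_ne_zero {x : E} (hx : x ≠ 0) : ∀ᵐ y ∂μ, inner ℝ x y ≠ 0 := by
  have h := Measure.addHaar_submodule μ (LinearMap.ker (innerSL ℝ x).toLinearMap) (by
    intro h
    have hmem : x ∈ LinearMap.ker (innerSL ℝ x).toLinearMap := h ▸ Submodule.mem_top
    exact hx (by simpa using hmem))
  rw [ae_iff]
  convert h using 2
  ext y
  simp

/-- An open half-space bounded by a hyperplane through the centre cuts a ball into halves. -/
lemma measureReal_closedBall_inter_inner_neg {x : E} (hx : x ≠ 0) (u : ℝ) :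
    μ.real (closedBall 0 u ∩ {y | inner ℝ x y < 0}) = μ.real (closedBall 0 u) / 2 := by
  have hmeas : MeasurableSet {y : E | inner ℝ x y < 0} :=
    (isOpen_lt (by fun_prop) continuous_const).measurableSet
  have hfin : μ (closedBall (0 : E) u) ≠ ⊤ := measure_closedBall_lt_top.ne
  have hsplit := measureReal_inter_add_sdiff (μ := μ) (s := closedBall (0 : E) u) hmeas hfin
  have hneg : μ.real (closedBall 0 u \ {y | inner ℝ x y < 0}) =
      μ.real (closedBall 0 u ∩ {y | inner ℝ x y < 0}) := by
    have hae : (closedBall 0 u \ {y | inner ℝ x y < 0} : Set E) =ᵐ[μ]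
        -(closedBall 0 u ∩ {y | inner ℝ x y < 0}) := by
      filter_upwards [ae_inner_ne_zero μ hx] with y hy
      apply propext
      change (y ∈ closedBall 0 u \ {y | inner ℝ x y < 0}) ↔
        y ∈ -(closedBall 0 u ∩ {y | inner ℝ x y < 0})
      have hlt : 0 ≤ inner ℝ x y ↔ 0 < inner ℝ x y := ⟨fun h => h.lt_of_ne' hy, le_of_lt⟩
      simp [hlt]
    rw [measureReal_congr hae, measureReal_def, Measure.measure_neg, measureReal_def]
  linarith

/-- The part of a rescaled neighbourhood of `x` lying in the ball of radius `‖x‖` has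
asymptotically the volume of a half-ball. -/
lemma tendsto_measureReal_closedBall_inter_norm_add_smul_le {x : E} (hx : x ≠ 0) (u : ℝ) :
    Tendsto (fun r : ℝ => μ.real (closedBall 0 u ∩ {y | ‖x + r • y‖ ≤ ‖x‖})) (𝓝[>] 0)
      (𝓝 (μ.real (closedBall 0 u) / 2)) := by
  rw [← measureReal_closedBall_inter_inner_neg μ hx u]
  have hmeas (r : ℝ) : MeasurableSet (closedBall 0 u ∩ {y : E | ‖x + r • y‖ ≤ ‖x‖}) :=
    (isClosed_closedBall.inter (isClosed_le (by fun_prop) continuous_const)).measurableSet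
  have hmeas' : MeasurableSet (closedBall 0 u ∩ {y : E | inner ℝ x y < 0}) :=
    isClosed_closedBall.measurableSet.inter
      (isOpen_lt (by fun_prop) continuous_const).measurableSet
  refine (ENNReal.tendsto_toReal
    (measure_ne_top_of_subset Set.inter_subset_left measure_closedBall_lt_top.ne)).comp
    (tendsto_measure_of_ae_tendsto_indicator (B := closedBall 0 u) _ hmeas' hmeas
      isClosed_closedBall.measurableSet measure_closedBall_lt_top.ne
      (Eventually.of_forall fun r => Set.inter_subset_left) ?_)
  filter_upwards [ae_inner_ne_zero μ hx] with y hy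
  have key : ∀ r : ℝ, 0 < r →
      (‖x + r • y‖ ≤ ‖x‖ ↔ 2 * inner ℝ x y + r * ‖y‖ ^ 2 ≤ 0) := by
    intro r hr
    rw [← sq_le_sq₀ (norm_nonneg _) (norm_nonneg _), norm_add_sq_real, inner_smul_right,
      norm_smul, Real.norm_of_nonneg hr.le]
    constructor
    · intro h
      by_contra! h'
      nlinarith [mul_pos hr h']
    · intro h
      nlinarith [mul_nonneg hr.le (neg_nonneg.2 h)]
  have hlim : Tendsto (fun r : ℝ => 2 * inner ℝ x y + r * ‖y‖ ^ 2) (𝓝[>] 0)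
      (𝓝 (2 * inner ℝ x y)) := by
    have hc : Continuous fun r : ℝ => 2 * inner ℝ x y + r * ‖y‖ ^ 2 := by fun_prop
    simpa using (hc.tendsto 0).mono_left nhdsWithin_le_nhds
  rcases hy.lt_or_gt with hy | hy
  · filter_upwards [self_mem_nhdsWithin, hlim.eventually_lt_const (u := 0) (by linarith)]
      with r hr h
    simp [key r hr, h.le, hy]
  · filter_upwards [self_mem_nhdsWithin, hlim.eventually_const_lt (u := 0) (by linarith)]
      with r hr h
    simp [key r hr, h.not_ge, hy.not_gt]

/-- Rescaling by `r` around `x` turns the intersection of two balls into a fixed ball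
intersected with a norm constraint. -/
lemma measureReal_closedBall_inter_closedBall_norm {x : E} {r u : ℝ} (hr : 0 < r) :
    μ.real (closedBall x (r * u) ∩ closedBall 0 ‖x‖) =
      r ^ Module.finrank ℝ E * μ.real (closedBall 0 u ∩ {y | ‖x + r • y‖ ≤ ‖x‖}) := by
  have hpre : (fun z => x + z) ⁻¹' (closedBall x (r * u) ∩ closedBall 0 ‖x‖) =
      r • (closedBall 0 u ∩ {y | ‖x + r • y‖ ≤ ‖x‖}) := by
    ext z
    rw [Set.mem_smul_set_iff_inv_smul_mem₀ hr.ne']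
    simp [smul_inv_smul₀ hr.ne', norm_smul, abs_of_pos hr, inv_mul_le_iff₀ hr, dist_eq_norm,
      add_comm z x]
  rw [measureReal_def, ← measure_preimage_add μ x, hpre, Measure.addHaar_smul,
    ENNReal.toReal_mul, ENNReal.toReal_ofReal (abs_nonneg _), abs_of_pos (pow_pos hr _),
    measureReal_def]

end HalfBall


/-- For every interior point `x ≠ 0` of `W` and `u ≥ 0`,
`t · λ_d(B(x, t^{-1/d} u) ∩ B(0, ‖x‖) ∩ W) → (κ_d/2) · u^d` as `t → ∞`. -/
theorem rst_small_ball_volume_limit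
    (d : ℕ) (hd : 2 ≤ d)
    (W : Set (EuclideanSpace ℝ (Fin d))) (hWcompact : IsCompact W)
    (hWconvex : Convex ℝ W) (hW0 : (0 : EuclideanSpace ℝ (Fin d)) ∈ W)
    (hWvol : 0 < volume W)
    (x : EuclideanSpace ℝ (Fin d)) (hx : x ∈ interior W) (hx0 : x ≠ 0)
    (u : ℝ) (hu : 0 ≤ u) :
    Tendsto (fun t : ℝ => t *
        (volume (closedBall x (t ^ (-(1 : ℝ) / (d : ℝ)) * u) ∩
          closedBall (0 : EuclideanSpace ℝ (Fin d)) ‖x‖ ∩ W)).toReal) atTop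
      (𝓝 ((volume (closedBall (0 : EuclideanSpace ℝ (Fin d)) 1)).toReal / 2 * u ^ d)) := by
  have hd0 : (d : ℝ) ≠ 0 := by positivity
  have hr : Tendsto (fun t : ℝ => t ^ (-(1 : ℝ) / (d : ℝ))) atTop (𝓝[>] 0) := by
    refine tendsto_nhdsWithin_iff.2 ⟨?_, ?_⟩
    · simpa only [neg_div] using tendsto_rpow_neg_atTop (y := 1 / (d : ℝ)) (by positivity)
    · filter_upwards [eventually_gt_atTop 0] with t ht
      exact Real.rpow_pos_of_pos ht _
  have hball : (volume (closedBall (0 : EuclideanSpace ℝ (Fin d)) 1)).toReal / 2 * u ^ d =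
      volume.real (closedBall (0 : EuclideanSpace ℝ (Fin d)) u) / 2 := by
    rw [measureReal_def, Measure.addHaar_closedBall' _ _ hu, ENNReal.toReal_mul,
      ENNReal.toReal_ofReal (by positivity), finrank_euclideanSpace_fin]
    ring
  rw [hball]
  refine ((tendsto_measureReal_closedBall_inter_norm_add_smul_le volume hx0 u).comp hr).congr' ?_
  obtain ⟨ε, hε, hεW⟩ := Metric.nhds_basis_closedBall.mem_iff.1 (mem_interior_iff_mem_nhds.1 hx)
  have hsmall : ∀ᶠ t : ℝ in atTop, t ^ (-(1 : ℝ) / (d : ℝ)) * u < ε := by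
    refine Tendsto.eventually_lt_const hε ?_
    simpa using (tendsto_nhds_of_tendsto_nhdsWithin hr).mul_const u
  filter_upwards [hsmall, eventually_gt_atTop 0] with t ht ht0
  have hpow : (t ^ (-(1 : ℝ) / (d : ℝ))) ^ d = t⁻¹ := by
    rw [← Real.rpow_mul_natCast ht0.le, div_mul_cancel₀ _ hd0, Real.rpow_neg_one]
  rw [Set.inter_eq_left.2 (Set.inter_subset_left.trans
    ((closedBall_subset_closedBall ht.le).trans hεW)), ← measureReal_def,
    measureReal_closedBall_inter_closedBall_norm volume (Real.rpow_pos_of_pos ht0 _),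
    finrank_euclideanSpace_fin, hpow, mul_inv_cancel_left₀ ht0.ne', Function.comp_apply]
end

section
/- Let k ∈ ℕ, R > 0 and let V ⊆ (ℝ^d)^{k+1} be a set such that ‖x_i − x_j‖ ≤ R for every (x_1, …, x_{k+1}) ∈ V and all i, j ∈ {1, …, k+1}. Then for every nonempty subset J ⊆ {1, …, k+1}, λ_d^{k+1}(V) ≤ (κ_d · R^d)^{k+1−|J|} · λ_d^{|J|}( Π_J(V) ), where Π_J denotes the projection of (ℝ^d)^{k+1} onto the components whose indices belong to J and |J| is the cardinality of J. -/
open MeasureTheory Metric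

/-- If the coordinates of the points of `V` lie within distance `R` of each other and balls of
radius `R` have measure at most `C`, then discarding the coordinates outside a nonempty index set
`J` costs at most a factor `C` per discarded coordinate. -/
theorem volume_pi_le_pow_mul_volume_image_restrict {ι E : Type*} [Fintype ι] [PseudoMetricSpace E]
    [SecondCountableTopology E] [MeasureSpace E] [OpensMeasurableSpace E]
    [SigmaFinite (volume : Measure E)] {R : ℝ} {C : ENNReal}
    (hC : ∀ x : E, volume (closedBall x R) ≤ C)
    {V : Set (ι → E)} (hV : ∀ x ∈ V, ∀ i j : ι, dist (x i) (x j) ≤ R)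
    (J : Finset ι) (hJ : J.Nonempty) :
    volume V ≤ C ^ (Fintype.card ι - J.card) *
      volume ((fun (x : ι → E) (j : {i // i ∈ J}) => x j.1) '' V) := by
  classical
  obtain ⟨i₀, hi₀⟩ := hJ
  set P := (fun (x : ι → E) (j : {i // i ∈ J}) => x j.1) '' V
  set S := toMeasurable volume P
  have hS : MeasurableSet S := measurableSet_toMeasurable _ _
  let T : Set (({i // i ∈ J} → E) × ({i // i ∉ J} → E)) :=
    {p | p.1 ∈ S ∧ ∀ j, dist (p.2 j) (p.1 ⟨i₀, hi₀⟩) ≤ R}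
  have hT : MeasurableSet T := by
    have hdist (j : {i // i ∉ J}) :
        MeasurableSet {p : ({i // i ∈ J} → E) × ({i // i ∉ J} → E) |
          dist (p.2 j) (p.1 ⟨i₀, hi₀⟩) ≤ R} :=
      measurableSet_le (((measurable_pi_apply j).comp measurable_snd).dist
        ((measurable_pi_apply _).comp measurable_fst)) measurable_const
    convert (measurable_fst hS).inter (MeasurableSet.iInter hdist)
    ext p
    simp [T]
  have hcard : Fintype.card {i // i ∉ J} = Fintype.card ι - J.card := by
    rw [Fintype.card_subtype_compl, Fintype.card_coe]
  have hfibre (y : {i // i ∈ J} → E) :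
      volume (Prod.mk y ⁻¹' T) ≤ S.indicator (fun _ => C ^ (Fintype.card ι - J.card)) y := by
    by_cases hy : y ∈ S
    · rw [Set.indicator_of_mem hy]
      calc volume (Prod.mk y ⁻¹' T)
          ≤ volume (Set.univ.pi fun _ : {i // i ∉ J} => closedBall (y ⟨i₀, hi₀⟩) R) :=
            measure_mono fun z hz j _ => hz.2 j
        _ = volume (closedBall (y ⟨i₀, hi₀⟩) R) ^ (Fintype.card ι - J.card) := by
            rw [volume_pi_pi, Finset.prod_const, Finset.card_univ, hcard]
        _ ≤ _ := by gcongr; exact hC _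
    · have : Prod.mk y ⁻¹' T = ∅ := Set.eq_empty_of_forall_notMem fun z hz => hy hz.1
      simp [this]
  have he : MeasurePreserving
      (MeasurableEquiv.piEquivPiSubtypeProd (fun _ : ι => E) (fun i => i ∈ J)) := by
    convert volume_preserving_piEquivPiSubtypeProd (fun _ : ι => E) (fun i => i ∈ J)
  calc volume V
      ≤ volume (MeasurableEquiv.piEquivPiSubtypeProd (fun _ : ι => E) (fun i => i ∈ J) ⁻¹' T) :=
        measure_mono fun x hx =>
          ⟨subset_toMeasurable _ _ (Set.mem_image_of_mem _ hx), fun j => hV x hx _ _⟩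
    _ = volume T := he.measure_preimage hT.nullMeasurableSet
    _ = ∫⁻ y, volume (Prod.mk y ⁻¹' T) := Measure.prod_apply hT
    _ ≤ ∫⁻ y, S.indicator (fun _ => C ^ (Fintype.card ι - J.card)) y := lintegral_mono hfibre
    _ = C ^ (Fintype.card ι - J.card) * volume P := by
        rw [lintegral_indicator_const hS, measure_toMeasurable]

open MeasureTheory Metric

/-- If `V ⊆ (ℝ^d)^{k+1}` is such that any two coordinates of a point of `V` are at distance at
most `R`, then for every nonempty index set `J`,
`λ_d^{k+1}(V) ≤ (κ_d R^d)^{k+1-|J|} · λ_d^{|J|}(Π_J(V))`. -/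
theorem volume_le_pow_mul_volume_proj
    (d : ℕ) (hd : 1 ≤ d) (k : ℕ) (R : ℝ) (hR : 0 < R)
    (V : Set (Fin (k + 1) → EuclideanSpace ℝ (Fin d)))
    (hV : ∀ x ∈ V, ∀ i j : Fin (k + 1), dist (x i) (x j) ≤ R)
    (J : Finset (Fin (k + 1))) (hJ : J.Nonempty) :
    volume V ≤
      ENNReal.ofReal ((volume (closedBall (0 : EuclideanSpace ℝ (Fin d)) 1)).toReal * R ^ d)
          ^ (k + 1 - J.card) *
        volume ((fun (x : Fin (k + 1) → EuclideanSpace ℝ (Fin d)) (j : {i // i ∈ J}) =>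
          x j.1) '' V) := by
  have hC (x : EuclideanSpace ℝ (Fin d)) : volume (closedBall x R) ≤ ENNReal.ofReal
      ((volume (closedBall (0 : EuclideanSpace ℝ (Fin d)) 1)).toReal * R ^ d) := by
    rw [Measure.addHaar_closedBall' _ _ hR.le, finrank_euclideanSpace_fin,
      ENNReal.ofReal_mul ENNReal.toReal_nonneg, ENNReal.ofReal_toReal measure_closedBall_lt_top.ne,
      mul_comm]
  simpa only [Fintype.card_fin] using volume_pi_le_pow_mul_volume_image_restrict hC hV J hJ
end
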